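/- arXiv:1109.5859 — 2 statements merged into one kernel-verified Lean document; each statement's English description precedes it below -/
import Mathlib

section
/- Let F ⊂ ℚ̄_p be a finite extension of ℚ_p, and let K, L ⊂ ℚ̄_p be finite Galois extensions of F with K/F totally ramified and L/F unramified. Then: (i) K ∩ L = F, and the map σ ↦ (σ|_K, σ|_L) is a group isomorphism Gal(KL/F) → Gal(K/F) × Gal(L/F); (ii) the extension KL/K is unramified of degree [L:F], and the extension KL/L is totally ramified of degree [K:F]; (iii) for every integer i ≥ −1, every σ ∈ Gal(KL/L) ∩ G_i(KL/F) satisfies σ|_K ∈ G_i(K/F), and restriction to K induces a group isomorphism Gal(KL/L) ∩ G_i(KL/F) → G_i(K/F). -/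
open scoped Classical
open IntermediateField

noncomputable section

/-- A fixed algebraic closure of the field `ℚ_p` of `p`-adic numbers. -/
abbrev Qpbar (p : ℕ) [Fact p.Prime] : Type := AlgebraicClosure ℚ_[p]

/-- The unique extension of the `p`-adic absolute value to the algebraic closure of
`ℚ_p`, given on an element `x` by `|N(x)|^(1/d)` where `N(x)` is the constant
coefficient of the minimal polynomial of `x` over `ℚ_p` and `d` its degree. -/
noncomputable def qpnorm (p : ℕ) [Fact p.Prime] (x : Qpbar p) : ℝ :=
  ‖(minpoly ℚ_[p] x).coeff 0‖ ^ (((minpoly ℚ_[p] x).natDegree : ℝ)⁻¹)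

/-- The absolute ramification index of a subfield of `Q̄_p` (given as a subset `S`):
the least `m ≥ 1` such that the absolute values of all nonzero elements of `S` lie in
the cyclic group generated by `p^(1/m)`.  A finite extension `K/F` inside `Q̄_p` is
unramified iff `eIdx K = eIdx F`, and totally ramified iff `eIdx K = [K:F] * eIdx F`. -/
def eIdx (p : ℕ) [Fact p.Prime] (S : Set (Qpbar p)) : ℕ :=
  sInf {m : ℕ | 0 < m ∧ ∀ x ∈ S, x ≠ 0 → ∃ k : ℤ, qpnorm p x ^ m = (p : ℝ) ^ k}

/-- The `i`-th higher ramification group (in lower numbering) of a finite Galois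
extension `M/F` inside `Q̄_p`, as a subset of its automorphism group:  the automorphisms
`σ` with `w(σ(a) - a) ≥ i + 1` for all integers `a` of `M`, where `w : M → ℤ ∪ {∞}` is
the surjective valuation of `M`; in terms of the absolute value, `w(x) ≥ i + 1` iff
`|x|_p ≤ p ^ (-(i+1)/e)` where `e` is the absolute ramification index of `M`. -/
def ramSet {p : ℕ} [Fact p.Prime] (F : IntermediateField ℚ_[p] (Qpbar p))
    (M : IntermediateField ↥F (Qpbar p)) (i : ℤ) :
    Set (↥M ≃ₐ[↥F] ↥M) :=
  {σ | ∀ x : ↥M, qpnorm p ↑x ≤ 1 →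
    qpnorm p ((σ x : Qpbar p) - (x : Qpbar p)) ≤
      (p : ℝ) ^ (-(((i : ℝ) + 1) / (eIdx p (M : Set (Qpbar p)))))}


theorem qpnorm_eq_norm {p : ℕ} [Fact p.Prime] (x : Qpbar p) : qpnorm p x = ‖x‖ := by
  rw [← PadicAlgCl.spectralNorm_eq, spectralNorm.spectralNorm_eq_norm_coeff_zero_rpow, qpnorm,
    one_div]

section RamificationIndex

variable {p : ℕ} [Fact p.Prime] {F : IntermediateField ℚ_[p] (Qpbar p)}

theorem exists_norm_pow_finrank_eq_zpow [FiniteDimensional ℚ_[p] F]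
    (M : IntermediateField F (Qpbar p)) [FiniteDimensional F M] {x : Qpbar p} (hx : x ∈ M)
    (hx0 : x ≠ 0) : ∃ k : ℤ, ‖x‖ ^ Module.finrank ℚ_[p] M = (p : ℝ) ^ k := by
  have : FiniteDimensional ℚ_[p] M := FiniteDimensional.trans ℚ_[p] F M
  have hint : IsIntegral ℚ_[p] x := Algebra.IsIntegral.isIntegral x
  have hdvd : (minpoly ℚ_[p] x).natDegree ∣ Module.finrank ℚ_[p] M := by
    have h := minpoly.degree_dvd (K := ℚ_[p]) (L := M) (Algebra.IsIntegral.isIntegral ⟨x, hx⟩)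
    have : IsScalarTower ℚ_[p] M (Qpbar p) := .of_algebraMap_eq fun _ ↦ rfl
    rwa [← minpoly.algebraMap_eq (algebraMap M (Qpbar p)).injective] at h
  have hdeg : (minpoly ℚ_[p] x).natDegree ≠ 0 := (minpoly.natDegree_pos hint).ne'
  have hpow : ‖x‖ ^ (minpoly ℚ_[p] x).natDegree = ‖(minpoly ℚ_[p] x).coeff 0‖ := by
    rw [← qpnorm_eq_norm, qpnorm, Real.rpow_inv_natCast_pow (norm_nonneg _) hdeg]
  obtain ⟨m, hm⟩ := hdvd
  refine ⟨-((minpoly ℚ_[p] x).coeff 0).valuation * m, ?_⟩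
  rw [hm, pow_mul, hpow, Padic.norm_eq_zpow_neg_valuation (minpoly.coeff_zero_ne_zero hint hx0),
    zpow_mul, zpow_natCast]

theorem eIdx_le {S : Set (Qpbar p)} {m : ℕ} (hm : 0 < m)
    (h : ∀ x ∈ S, x ≠ 0 → ∃ k : ℤ, ‖x‖ ^ m = (p : ℝ) ^ k) : eIdx p S ≤ m :=
  Nat.sInf_le ⟨hm, by simpa only [qpnorm_eq_norm] using h⟩

theorem eIdx_spec [FiniteDimensional ℚ_[p] F] (M : IntermediateField F (Qpbar p))
    [FiniteDimensional F M] :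
    0 < eIdx p (M : Set (Qpbar p)) ∧
      ∀ x ∈ M, x ≠ 0 → ∃ k : ℤ, ‖x‖ ^ eIdx p (M : Set (Qpbar p)) = (p : ℝ) ^ k := by
  have : FiniteDimensional ℚ_[p] M := FiniteDimensional.trans ℚ_[p] F M
  have h : eIdx p (M : Set (Qpbar p)) ∈ _ := Nat.sInf_mem
    (s := {m : ℕ | 0 < m ∧ ∀ x ∈ (M : Set (Qpbar p)), x ≠ 0 → ∃ k : ℤ, qpnorm p x ^ m = (p : ℝ) ^ k})
    ⟨Module.finrank ℚ_[p] M, Module.finrank_pos, by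
      simpa only [qpnorm_eq_norm, SetLike.mem_coe] using
        fun x hx hx0 ↦ exists_norm_pow_finrank_eq_zpow M hx hx0⟩
  simpa only [qpnorm_eq_norm, SetLike.mem_coe, Set.mem_ofPred_eq] using h

/-- A uniformizer exists in every finite extension of `ℚ_p`. -/
theorem exists_norm_pow_eIdx_eq_inv [FiniteDimensional ℚ_[p] F]
    (M : IntermediateField F (Qpbar p)) [FiniteDimensional F M] :
    ∃ π ∈ M, ‖π‖ ^ eIdx p (M : Set (Qpbar p)) = (p : ℝ)⁻¹ := by
  obtain ⟨he, hval⟩ := eIdx_spec M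
  set e := eIdx p (M : Set (Qpbar p))
  have hp0 : (0 : ℝ) < p := by exact_mod_cast (Fact.out : p.Prime).pos
  let H : AddSubgroup ℤ :=
    { carrier := {k | ∃ x ∈ M, x ≠ 0 ∧ ‖x‖ ^ e = (p : ℝ) ^ k}
      zero_mem' := ⟨1, one_mem M, one_ne_zero, by simp⟩
      add_mem' := by
        rintro a b ⟨x, hx, hx0, hxa⟩ ⟨y, hy, hy0, hyb⟩
        exact ⟨x * y, mul_mem hx hy, mul_ne_zero hx0 hy0, by
          rw [norm_mul, mul_pow, hxa, hyb, zpow_add₀ hp0.ne']⟩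
      neg_mem' := by
        rintro a ⟨x, hx, hx0, hxa⟩
        exact ⟨x⁻¹, inv_mem hx, inv_ne_zero hx0, by rw [norm_inv, inv_pow, hxa, zpow_neg]⟩ }
  obtain ⟨d, hd⟩ := Int.subgroup_cyclic H
  have hmem (k : ℤ) : k ∈ H ↔ d ∣ k := by
    rw [hd, ← AddSubgroup.zmultiples_eq_closure, Int.mem_zmultiples_iff]
  have heH : -(e : ℤ) ∈ H := by
    have hpn : ‖(p : Qpbar p)‖ = (p : ℝ)⁻¹ := by
      rw [← map_natCast (algebraMap ℚ_[p] (Qpbar p)), PadicAlgCl.norm_extends, Padic.norm_p]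
    refine ⟨p, IntermediateField.natCast_mem M p,
      Nat.cast_ne_zero.2 (Fact.out : p.Prime).ne_zero, ?_⟩
    rw [hpn, zpow_neg, zpow_natCast, inv_pow]
  obtain ⟨m, hm⟩ : d.natAbs ∣ e := by
    simpa [Int.natAbs_dvd_natAbs] using Int.natAbs_dvd_natAbs.2 ((hmem _).1 heH)
  have hd0 : d.natAbs ≠ 0 := by rintro h; simp [h] at hm; omega
  have hm0 : 0 < m := Nat.pos_of_ne_zero (by rintro rfl; simp at hm; omega)
  have hle : e ≤ m := by
    refine eIdx_le hm0 fun x hx hx0 ↦ ?_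
    obtain ⟨k, hk⟩ := hval x hx hx0
    obtain ⟨l, hl⟩ := Int.natAbs_dvd.2 ((hmem k).1 ⟨x, hx, hx0, hk⟩)
    refine ⟨l, (pow_left_inj₀ (by positivity) (by positivity) hd0).1 ?_⟩
    rw [← pow_mul, mul_comm m, ← hm, hk, hl, mul_comm, zpow_mul, zpow_natCast]
  have hd1 : d.natAbs = 1 := by
    rw [hm] at hle
    have := Nat.le_of_mul_le_mul_right (by simpa using hle : d.natAbs * m ≤ 1 * m) hm0
    omega
  obtain ⟨π, hπ, -, h⟩ := (hmem (-1)).2 (by rw [← Int.natAbs_dvd, hd1]; simp)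
  exact ⟨π, hπ, by simpa using h⟩

end RamificationIndex

theorem exists_restrict_monoidHom {F E : Type*} [Field F] [Field E] [Algebra F E]
    {A M : IntermediateField F E} (h : A ≤ M) [Normal F A] :
    ∃ r : (M ≃ₐ[F] M) →* (A ≃ₐ[F] A), ∀ σ (x : A) (hx : (x : E) ∈ M),
      ((r σ x : A) : E) = (σ ⟨x, hx⟩ : M) := by
  let _ : Algebra A M := (inclusion h).toAlgebra
  have : IsScalarTower F A M := IsScalarTower.of_algebraMap_eq fun _ ↦ rfl
  exact ⟨AlgEquiv.restrictNormalHom A, fun σ x _ ↦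
    congrArg Subtype.val (σ.restrictNormal_commutes A x)⟩

section Expansion

variable {p : ℕ} [Fact p.Prime] {F : IntermediateField ℚ_[p] (Qpbar p)}

theorem norm_mul_pow_pow_eq_zpow {e n : ℕ} {π c : Qpbar p} {k : ℤ}
    (hπ : ‖π‖ ^ (n * e) = (p : ℝ)⁻¹) (hk : ‖c‖ ^ e = (p : ℝ) ^ k) (j : ℕ) :
    ‖c * π ^ j‖ ^ (n * e) = (p : ℝ) ^ (k * n - j) := by
  have hp0 : (p : ℝ) ≠ 0 := by exact_mod_cast (Fact.out : p.Prime).ne_zero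
  rw [norm_mul, mul_pow, norm_pow, ← pow_mul, mul_comm j, pow_mul ‖π‖, hπ, mul_comm n, pow_mul,
    hk, zpow_sub₀ hp0, zpow_mul, zpow_natCast, zpow_natCast, inv_pow, div_eq_mul_inv]

/-- If the values of `1, π, …, π^(n-1)` lie in distinct cosets of the value group of `L`, then the
norm of an `L`-linear combination of these powers is the maximum of the norms of its terms. -/
theorem norm_sum_mul_pow (L : IntermediateField F (Qpbar p)) {e n : ℕ} {π : Qpbar p}
    (hL : ∀ x ∈ L, x ≠ 0 → ∃ k : ℤ, ‖x‖ ^ e = (p : ℝ) ^ k)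
    (hπ : ‖π‖ ^ (n * e) = (p : ℝ)⁻¹) (c : Fin n → L) :
    (∀ j, ‖(c j : Qpbar p) * π ^ (j : ℕ)‖ ≤ ‖∑ j, (c j : Qpbar p) * π ^ (j : ℕ)‖) ∧
      (∑ j, (c j : Qpbar p) * π ^ (j : ℕ) ≠ 0 → ∃ j, c j ≠ 0 ∧
        ‖∑ j, (c j : Qpbar p) * π ^ (j : ℕ)‖ = ‖(c j : Qpbar p) * π ^ (j : ℕ)‖) := by
  have hp1 : (1 : ℝ) < p := by exact_mod_cast (Fact.out : p.Prime).one_lt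
  have hp0 : (0 : ℝ) < p := by linarith
  set f : Fin n → Qpbar p := fun j ↦ (c j : Qpbar p) * π ^ (j : ℕ) with hf
  set s : Finset (Fin n) := Finset.univ.filter fun j ↦ c j ≠ 0 with hs
  have hsum : ∑ j, f j = ∑ j ∈ s, f j := by
    refine (Finset.sum_filter_of_ne (p := fun j ↦ c j ≠ 0) fun j _ hj hc ↦ hj ?_).symm
    simp [hf, hc]
  have hterm (j : Fin n) (hj : c j ≠ 0) :
      ∃ k : ℤ, ‖f j‖ ^ (n * e) = (p : ℝ) ^ (k * n - (j : ℕ)) := by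
    obtain ⟨k, hk⟩ := hL (c j) (c j).2 (by simpa using hj)
    exact ⟨k, norm_mul_pow_pow_eq_zpow hπ hk j⟩
  have hpw : Set.Pairwise (s : Set (Fin n)) fun i j ↦ ‖f i‖ ≠ ‖f j‖ := by
    intro i hi j hj hij heq
    obtain ⟨k, hk⟩ := hterm i (by simpa [hs] using hi)
    obtain ⟨l, hl⟩ := hterm j (by simpa [hs] using hj)
    rw [heq, hl] at hk
    have h := zpow_right_injective₀ hp0 hp1.ne' hk
    have hmod : (n : ℤ) ∣ (i : ℕ) - (j : ℕ) := ⟨k - l, by linarith⟩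
    have := Int.eq_zero_of_abs_lt_dvd hmod (by rw [abs_lt]; omega)
    exact hij (Fin.ext (by omega))
  rcases s.eq_empty_or_nonempty with h0 | h0
  · rw [hsum, h0]
    refine ⟨fun j ↦ ?_, by simp⟩
    have : c j = 0 := by
      by_contra h
      have : j ∈ s := by simpa [hs] using h
      simp [h0] at this
    simp [this]
  · have hnorm := IsUltrametricDist.norm_sum_eq_sup'_of_pairwise_ne h0 hpw
    rw [hsum, hnorm]
    refine ⟨fun j ↦ ?_, fun _ ↦ ?_⟩
    · by_cases hj : c j = 0
      · obtain ⟨i, hi⟩ := h0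
        rw [hj]
        simpa using (norm_nonneg (f i)).trans (Finset.le_sup' (fun i ↦ ‖f i‖) hi)
      · exact Finset.le_sup' (fun i ↦ ‖f i‖) (by simpa [hs] using hj : j ∈ s)
    · obtain ⟨j, hj, h⟩ := Finset.exists_mem_eq_sup' h0 fun i ↦ ‖f i‖
      exact ⟨j, by simpa [hs] using hj, h⟩

theorem linearIndependent_pow_of_norm (L : IntermediateField F (Qpbar p)) {e n : ℕ} {π : Qpbar p}
    (hL : ∀ x ∈ L, x ≠ 0 → ∃ k : ℤ, ‖x‖ ^ e = (p : ℝ) ^ k)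
    (hπ : ‖π‖ ^ (n * e) = (p : ℝ)⁻¹) (hπ0 : π ≠ 0) :
    LinearIndependent L fun j : Fin n ↦ π ^ (j : ℕ) := by
  rw [Fintype.linearIndependent_iff]
  intro c hc j
  have h := (norm_sum_mul_pow L hL hπ c).1 j
  simp only [Algebra.smul_def, IntermediateField.algebraMap_apply] at hc
  rw [hc, norm_zero, norm_le_zero_iff] at h
  simpa [hπ0] using h

theorem norm_coeff_le_one_of_norm_mul_pow_le_one (L : IntermediateField F (Qpbar p)) {e n j : ℕ}
    {π c : Qpbar p} (hL : ∀ x ∈ L, x ≠ 0 → ∃ k : ℤ, ‖x‖ ^ e = (p : ℝ) ^ k) 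
    (hπ : ‖π‖ ^ (n * e) = (p : ℝ)⁻¹) (hc : c ∈ L) (hj : j < n)
    (h : ‖c * π ^ j‖ ≤ 1) : ‖c‖ ≤ 1 := by
  have hp1 : (1 : ℝ) < p := by exact_mod_cast (Fact.out : p.Prime).one_lt
  have hp0 : (0 : ℝ) < p := by linarith
  rcases eq_or_ne c 0 with rfl | hc0
  · simp
  have he : e ≠ 0 := by
    rintro rfl
    rw [mul_zero, pow_zero] at hπ
    exact (inv_lt_one_of_one_lt₀ hp1).ne' hπ
  obtain ⟨k, hk⟩ := hL c hc hc0
  have hpow : (p : ℝ) ^ (k * n - j) ≤ 1 := by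
    calc (p : ℝ) ^ (k * n - j) = ‖c * π ^ j‖ ^ (n * e) :=
          (norm_mul_pow_pow_eq_zpow hπ hk j).symm
      _ ≤ 1 := pow_le_one₀ (norm_nonneg _) h
  have hle : k * n - j ≤ 0 := by
    rwa [← zpow_zero (p : ℝ), zpow_le_zpow_iff_right₀ hp1] at hpow
  have hk0 : k ≤ 0 := by
    by_contra! hk0
    nlinarith
  rw [← pow_le_one_iff_of_nonneg (norm_nonneg c) he, hk]
  exact zpow_le_one_of_nonpos₀ hp1.le hk0

end Expansion

theorem exists_sum_basis_of_mem_sup {F E ι : Type*} [Field F] [Field E] [Algebra F E] [Fintype ι]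
    {K L : IntermediateField F E} [FiniteDimensional F K] (b : Module.Basis ι F K) {x : E}
    (hx : x ∈ K ⊔ L) : ∃ c : ι → L, x = ∑ j, (c j : E) * (b j : E) := by
  have hx' : x ∈ Subalgebra.toSubmodule K.toSubalgebra * Subalgebra.toSubmodule L.toSubalgebra := by
    rw [Subalgebra.mul_toSubmodule, ← sup_toSubalgebra_of_left]
    exact hx
  induction hx' using Submodule.mul_induction_on' with
  | mem_mul_mem k hk l hl =>
    refine ⟨fun j ↦ b.repr ⟨k, hk⟩ j • ⟨l, hl⟩, ?_⟩
    have h := congrArg (Subtype.val : K → E) (b.sum_repr ⟨k, hk⟩)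
    simp only [AddSubmonoidClass.coe_finsetSum, IntermediateField.coe_smul] at h
    simp only [IntermediateField.coe_smul]
    refine (congrArg (· * l) h.symm).trans ?_
    refine (Finset.sum_mul _ _ _).trans (Finset.sum_congr rfl fun j _ ↦ ?_)
    rw [smul_mul_assoc, smul_mul_assoc, mul_comm]
  | add x hx' y hy' ihx ihy =>
    rw [Subalgebra.mul_toSubmodule, ← sup_toSubalgebra_of_left] at hx' hy'
    obtain ⟨c, rfl⟩ := ihx hx'
    obtain ⟨d, rfl⟩ := ihy hy'
    exact ⟨c + d, by simp [add_mul, Finset.sum_add_distrib]⟩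

set_option maxHeartbeats 400000 in
/-- **Lemma (totally ramified and unramified extensions).**  Let `F ⊆ Q̄_p` be a finite
extension of `ℚ_p` and let `K, L ⊆ Q̄_p` be finite Galois extensions of `F`, with `K/F`
totally ramified and `L/F` unramified.  Then:
(i) `K ∩ L = F`, and `σ ↦ (σ|_K, σ|_L)` is an isomorphism
    `Gal(KL/F) → Gal(K/F) × Gal(L/F)` (the restrictions `σ|_K, σ|_L` are expressed by
    the homomorphisms `rK, rL` together with their characterising properties);
(ii) `KL/K` is unramified of degree `[L:F]` and `KL/L` is totally ramified of degree
    `[K:F]` (expressed via `eIdx` and degrees over `F`);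
(iii) for every `i ≥ -1`, each `σ ∈ Gal(KL/L) ∩ G_i(KL/F)` satisfies
    `σ|_K ∈ G_i(K/F)`, and restriction to `K` is a bijection (hence an isomorphism of
    groups, being the restriction of the homomorphism `rK`) from
    `Gal(KL/L) ∩ G_i(KL/F)` onto `G_i(K/F)`. -/
theorem totallyRamified_unramified_compositum (p : ℕ) [Fact p.Prime]
    (F : IntermediateField ℚ_[p] (Qpbar p)) [FiniteDimensional ℚ_[p] ↥F]
    (K L : IntermediateField ↥F (Qpbar p))
    [FiniteDimensional ↥F ↥K] [IsGalois ↥F ↥K]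
    [FiniteDimensional ↥F ↥L] [IsGalois ↥F ↥L]
    (hKtr : eIdx p (K : Set (Qpbar p)) =
      Module.finrank ↥F ↥K * eIdx p (F : Set (Qpbar p)))
    (hLunr : eIdx p (L : Set (Qpbar p)) = eIdx p (F : Set (Qpbar p))) :
    K ⊓ L = ⊥ ∧
    ∃ (rK : (↥(K ⊔ L) ≃ₐ[↥F] ↥(K ⊔ L)) →* (↥K ≃ₐ[↥F] ↥K))
      (rL : (↥(K ⊔ L) ≃ₐ[↥F] ↥(K ⊔ L)) →* (↥L ≃ₐ[↥F] ↥L)),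
      (∀ σ (x : ↥K) (hx : (x : Qpbar p) ∈ K ⊔ L),
        ((rK σ) x : Qpbar p) = (σ ⟨(x : Qpbar p), hx⟩ : Qpbar p)) ∧
      (∀ σ (x : ↥L) (hx : (x : Qpbar p) ∈ K ⊔ L),
        ((rL σ) x : Qpbar p) = (σ ⟨(x : Qpbar p), hx⟩ : Qpbar p)) ∧
      Function.Bijective (fun σ => (rK σ, rL σ)) ∧
      Module.finrank ↥F ↥(K ⊔ L) = Module.finrank ↥F ↥K * Module.finrank ↥F ↥L ∧
      eIdx p ((K ⊔ L : IntermediateField ↥F (Qpbar p)) : Set (Qpbar p)) =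
        eIdx p (K : Set (Qpbar p)) ∧
      eIdx p ((K ⊔ L : IntermediateField ↥F (Qpbar p)) : Set (Qpbar p)) *
          Module.finrank ↥F ↥L =
        eIdx p (L : Set (Qpbar p)) * Module.finrank ↥F ↥(K ⊔ L) ∧
      ∀ i : ℤ, -1 ≤ i →
        (∀ σ : ↥(K ⊔ L) ≃ₐ[↥F] ↥(K ⊔ L),
          (∀ x : ↥(K ⊔ L), (x : Qpbar p) ∈ L → σ x = x) →
          σ ∈ ramSet F (K ⊔ L) i → rK σ ∈ ramSet F K i) ∧
        Set.BijOn rK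
          {σ : ↥(K ⊔ L) ≃ₐ[↥F] ↥(K ⊔ L) |
            (∀ x : ↥(K ⊔ L), (x : Qpbar p) ∈ L → σ x = x) ∧ σ ∈ ramSet F (K ⊔ L) i}
          (ramSet F K i) := by
  obtain ⟨-, hLval⟩ := eIdx_spec L
  obtain ⟨heK, -⟩ := eIdx_spec K
  obtain ⟨π, hπK, hπ⟩ := exists_norm_pow_eIdx_eq_inv K
  have hp1 : (1 : ℝ) < p := by exact_mod_cast (Fact.out : p.Prime).one_lt
  have hp0 : (0 : ℝ) < p := by linarith
  have hπ0 : π ≠ 0 := by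
    rintro rfl
    rw [norm_zero, zero_pow heK.ne'] at hπ
    exact (inv_pos.2 hp0).ne hπ
  have hπ1 : ‖π‖ < 1 := by
    by_contra! h
    exact (inv_lt_one_of_one_lt₀ hp1).not_ge (hπ ▸ one_le_pow₀ h)
  rw [← hLunr] at hKtr
  set n := Module.finrank F K with hn
  have hπn : ‖π‖ ^ (n * eIdx p (L : Set (Qpbar p))) = (p : ℝ)⁻¹ := hKtr ▸ hπ
  have hlinL := linearIndependent_pow_of_norm L hLval hπn hπ0
  have hlinF : LinearIndependent F fun j : Fin n ↦ (⟨π, hπK⟩ : K) ^ (j : ℕ) := by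
    refine LinearIndependent.of_comp K.val.toLinearMap ?_
    refine LinearIndependent.restrict_scalars (K := L) ?_ hlinL
    simpa [Algebra.smul_def] using (algebraMap F L).injective
  have hnpos : 0 < n := Module.finrank_pos
  have : Nonempty (Fin n) := ⟨⟨0, hnpos⟩⟩
  let b : Module.Basis (Fin n) F K := basisOfLinearIndependentOfCardEqFinrank hlinF (by simp [hn])
  have hb (j : Fin n) : b j = (⟨π, hπK⟩ : K) ^ (j : ℕ) := by simp [b]
  have hdisj : K.LinearDisjoint L := by
    refine LinearDisjoint.of_basis_left b ?_
    have hcomp : K.val ∘ b = fun j : Fin n ↦ π ^ (j : ℕ) := by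
      ext j
      simp [hb]
    rw [hcomp]
    exact hlinL
  have hexp {x : Qpbar p} (hx : x ∈ K ⊔ L) :
      ∃ c : Fin n → L, x = ∑ j, (c j : Qpbar p) * π ^ (j : ℕ) := by
    obtain ⟨c, hc⟩ := exists_sum_basis_of_mem_sup b hx
    exact ⟨c, by simpa [hb] using hc⟩
  have hfin : Module.finrank F ↥(K ⊔ L) = n * Module.finrank F L := hdisj.finrank_sup
  have heKL : eIdx p ((K ⊔ L : IntermediateField F (Qpbar p)) : Set (Qpbar p)) =
      eIdx p (K : Set (Qpbar p)) := by
    obtain ⟨hpos, hval⟩ := eIdx_spec (K ⊔ L)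
    refine le_antisymm (eIdx_le heK fun x hx hx0 ↦ ?_)
      (eIdx_le hpos fun x hx ↦ hval x (le_sup_left (a := K) hx))
    obtain ⟨c, rfl⟩ := hexp hx
    obtain ⟨j, hj, h⟩ := (norm_sum_mul_pow L hLval hπn c).2 hx0
    obtain ⟨k, hk⟩ := hLval (c j) (c j).2 (by simpa using hj)
    refine ⟨k * n - (j : ℕ), ?_⟩
    rw [h, hKtr, norm_mul_pow_pow_eq_zpow hπn hk]
  obtain ⟨rK, hrK⟩ := exists_restrict_monoidHom (le_sup_left (a := K) (b := L))
  obtain ⟨rL, hrL⟩ := exists_restrict_monoidHom (le_sup_right (a := K) (b := L))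
  have happly (σ : ↥(K ⊔ L) ≃ₐ[F] ↥(K ⊔ L)) (c : Fin n → L) (x : ↥(K ⊔ L))
      (hx : (x : Qpbar p) = ∑ j, (c j : Qpbar p) * π ^ (j : ℕ)) :
      (σ x : Qpbar p) = ∑ j, (rL σ (c j) : Qpbar p) * (rK σ ⟨π, hπK⟩ : Qpbar p) ^ (j : ℕ) := by
    have hx' : x = ∑ j, (⟨c j, le_sup_right (a := K) (c j).2⟩ : ↥(K ⊔ L)) *
        ⟨π, le_sup_left (b := L) hπK⟩ ^ (j : ℕ) := by
      apply Subtype.ext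
      simpa using hx
    rw [hx']
    simp only [map_sum, map_mul, map_pow, AddSubmonoidClass.coe_finsetSum,
      IntermediateField.coe_mul, IntermediateField.coe_pow]
    refine Finset.sum_congr rfl fun j _ ↦ ?_
    rw [hrL σ (c j) (le_sup_right (a := K) (c j).2), hrK σ ⟨π, hπK⟩ (le_sup_left (b := L) hπK)]
  have hinj : Function.Injective fun σ ↦ (rK σ, rL σ) := by
    intro σ τ h
    simp only [Prod.mk.injEq] at h
    ext x
    obtain ⟨c, hc⟩ := hexp x.2
    rw [happly σ c x hc, happly τ c x hc, h.1, h.2]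
  have hbij : Function.Bijective fun σ ↦ (rK σ, rL σ) := by
    refine (Nat.bijective_iff_injective_and_card _).2 ⟨hinj, ?_⟩
    rw [Nat.card_prod, IsGalois.card_aut_eq_finrank, IsGalois.card_aut_eq_finrank,
      IsGalois.card_aut_eq_finrank, hfin]
  have hfix (σ : ↥(K ⊔ L) ≃ₐ[F] ↥(K ⊔ L)) :
      (∀ x : ↥(K ⊔ L), (x : Qpbar p) ∈ L → σ x = x) ↔ rL σ = 1 := by
    refine ⟨fun h ↦ ?_, fun h x hx ↦ Subtype.ext ?_⟩
    · ext x
      have hx := le_sup_right (a := K) x.2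
      rw [hrL σ x hx, h ⟨x, hx⟩ x.2]
      rfl
    · have := hrL σ ⟨x, hx⟩ x.2
      rw [h] at this
      exact this.symm
  have hmaps (i : ℤ) (σ : ↥(K ⊔ L) ≃ₐ[F] ↥(K ⊔ L)) (hσ : σ ∈ ramSet F (K ⊔ L) i) :
      rK σ ∈ ramSet F K i := by
    intro x hx
    have hxKL := le_sup_left (b := L) x.2
    have h := hσ ⟨x, hxKL⟩ hx
    rwa [heKL, ← hrK σ x hxKL] at h
  refine ⟨hdisj.inf_eq_bot, rK, rL, hrK, hrL, hbij, hfin, heKL, ?_, fun i _ ↦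
    ⟨fun σ _ hσ ↦ hmaps i σ hσ, fun σ hσ ↦ hmaps i σ hσ.2, ?_, ?_⟩⟩
  · rw [heKL, hfin, hKtr]
    ring
  · intro σ hσ τ hτ h
    exact hinj (Prod.ext h (((hfix σ).1 hσ.1).trans ((hfix τ).1 hτ.1).symm))
  · intro τ hτ
    obtain ⟨σ, hσ⟩ := hbij.2 (τ, 1)
    simp only [Prod.mk.injEq] at hσ
    refine ⟨σ, ⟨(hfix σ).2 hσ.2, fun x hx ↦ ?_⟩, hσ.1⟩
    obtain ⟨c, hc⟩ := hexp x.2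
    rw [happly σ c x hc, hσ.1, hσ.2, hc, ← Finset.sum_sub_distrib, heKL, qpnorm_eq_norm]
    refine IsUltrametricDist.norm_sum_le_of_forall_le_of_nonneg (by positivity) fun j _ ↦ ?_
    have hτj := hτ (⟨π, hπK⟩ ^ (j : ℕ)) (by
      simpa [qpnorm_eq_norm] using pow_le_one₀ (norm_nonneg π) hπ1.le)
    rw [qpnorm_eq_norm, map_pow, IntermediateField.coe_pow, IntermediateField.coe_pow] at hτj
    rw [AlgEquiv.one_apply, ← mul_sub, norm_mul]
    refine (mul_le_of_le_one_left (norm_nonneg _) ?_).trans hτj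
    rw [qpnorm_eq_norm, hc] at hx
    exact norm_coeff_le_one_of_norm_mul_pow_le_one L hLval hπn (c j).2 j.2
      (((norm_sum_mul_pow L hLval hπn c).1 j).trans hx)

end
end

section
/- Let p ≥ 5 be a prime and let G be a non-split Cartan subgroup of GL₂(𝔽_p) (equivalently, a cyclic subgroup of order p² − 1). Then the set {h·g·h⁻¹ : g ∈ G, h ∈ GL₂(𝔽_p)} has cardinality strictly greater than p³, and it generates GL₂(𝔽_p) as a group. -/
namespace Matrix

variable {K : Type*} [Field K]

theorem apply_one_zero_ne_zero_of_not_isSquare_discr {A : Matrix (Fin 2) (Fin 2) K}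
    (hA : ¬ IsSquare A.discr) : A 1 0 ≠ 0 := by
  intro h
  refine hA ⟨A 0 0 - A 1 1, ?_⟩
  rw [discr_fin_two, trace_fin_two, det_fin_two, h]
  ring

/-- A matrix whose lower left entry does not vanish is conjugate to its companion matrix. -/
theorem exists_mul_eq_mul_companion {A : Matrix (Fin 2) (Fin 2) K} (hA : A 1 0 ≠ 0) :
    ∃ P : GL (Fin 2) K, A * P = P * !![0, -A.det; 1, A.trace] := by
  refine ⟨GeneralLinearGroup.mkOfDetNeZero !![1, A 0 0; 0, A 1 0] (by simpa using hA), ?_⟩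
  ext i j
  fin_cases i <;> fin_cases j <;>
    simp [GeneralLinearGroup.mkOfDetNeZero, mul_apply, Fin.sum_univ_two, det_fin_two,
      trace_fin_two] <;> ring

theorem GeneralLinearGroup.exists_eq_conj_of_trace_eq_of_det_eq {A B : GL (Fin 2) K}
    (hA : ¬ IsSquare A.val.discr) (htr : B.val.trace = A.val.trace)
    (hdet : B.val.det = A.val.det) : ∃ P : GL (Fin 2) K, B = P * A * P⁻¹ := by
  have hB : ¬ IsSquare B.val.discr := by
    rwa [discr_fin_two, htr, hdet, ← discr_fin_two]
  obtain ⟨P, hP⟩ :=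
    exists_mul_eq_mul_companion (apply_one_zero_ne_zero_of_not_isSquare_discr hA)
  obtain ⟨Q, hQ⟩ :=
    exists_mul_eq_mul_companion (apply_one_zero_ne_zero_of_not_isSquare_discr hB)
  rw [htr, hdet] at hQ
  refine ⟨Q * P⁻¹, ?_⟩
  have h : P⁻¹ * A * P = Q⁻¹ * B * Q := by
    apply Units.ext
    rw [mul_assoc, mul_assoc, Units.val_mul, Units.val_mul, Units.val_mul _ (B * Q),
      Units.val_mul B, hP, hQ, Units.inv_mul_cancel_left, Units.inv_mul_cancel_left]
  calc B = Q * (Q⁻¹ * B * Q) * Q⁻¹ := by group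
    _ = Q * (P⁻¹ * A * P) * Q⁻¹ := by rw [h]
    _ = _ := by group

theorem det_ne_zero_of_not_isSquare_discr {A : Matrix (Fin 2) (Fin 2) K}
    (hA : ¬ IsSquare A.discr) : A.det ≠ 0 := by
  intro h
  exact hA ⟨A.trace, by rw [discr_fin_two, h]; ring⟩

theorem exists_pow_eq_smul_one_add_smul (A : Matrix (Fin 2) (Fin 2) K) (n : ℕ) :
    ∃ x : K × K, A ^ n = x.1 • 1 + x.2 • A := by
  induction n with
  | zero => exact ⟨(1, 0), by simp⟩
  | succ n ih =>
    obtain ⟨⟨a, b⟩, h⟩ := ih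
    refine ⟨(-b * A.det, a + b * A.trace), ?_⟩
    rw [pow_succ, h]
    ext i j
    fin_cases i <;> fin_cases j <;>
      simp [mul_apply, Fin.sum_univ_two, det_fin_two, trace_fin_two] <;> ring

end Matrix

/-- If `ZMod p` contains a nonsquare, its squares are not stable under subtracting a nonzero
constant. -/
theorem ZMod.exists_not_isSquare_sq_sub {p : ℕ} [Fact p.Prime] {c D : ZMod p} (hc : c ≠ 0)
    (hD : ¬ IsSquare D) : ∃ t : ZMod p, ¬ IsSquare (t ^ 2 - c) := by
  by_contra! h
  have key (n : ℕ) : IsSquare (n * (-c)) := by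
    induction n with
    | zero => simp
    | succ n ih =>
      obtain ⟨s, hs⟩ := ih
      convert h s using 1
      push_cast
      linear_combination hs
  apply hD
  convert key (D / (-c)).val using 1
  rw [ZMod.natCast_zmod_val]
  field_simp

section NonsplitCartan

variable {p : ℕ} [Fact p.Prime]

open Matrix

/-- The nonzero elements of the algebra spanned by a generator `g` of a cyclic group of order
`p ^ 2 - 1` all belong to that group. -/
theorem exists_mem_val_eq_smul_one_add_smul {G : Subgroup (GL (Fin 2) (ZMod p))}
    (hcard : Nat.card G = p ^ 2 - 1) {g : GL (Fin 2) (ZMod p)}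
    (hg : ∀ x ∈ G, x ∈ Subgroup.zpowers g) {x : ZMod p × ZMod p} (hx : x ≠ 0) :
    ∃ y ∈ G, y.val = x.1 • 1 + x.2 • g.val := by
  have hp : 0 < p ^ 2 := pow_pos (Fact.out : p.Prime).pos 2
  set f : ZMod p × ZMod p → Matrix (Fin 2) (Fin 2) (ZMod p) :=
    fun x ↦ x.1 • 1 + x.2 • g.val with hf
  set T : Set (Matrix (Fin 2) (Fin 2) (ZMod p)) := insert 0 (Units.val '' (G : Set _)) with hT
  have hTcard : T.ncard = p ^ 2 := by
    rw [hT, Set.ncard_insert_of_notMem, Set.ncard_image_of_injective _ Units.val_injective]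
    · change Nat.card G + 1 = _
      omega
    · rintro ⟨y, -, hy⟩
      exact y.ne_zero hy
  have hsub : T ⊆ Set.range f := by
    rintro _ (rfl | ⟨y, hy, rfl⟩)
    · exact ⟨0, by simp [hf]⟩
    · obtain ⟨n, rfl⟩ := mem_powers_iff_mem_zpowers.mpr (hg y hy)
      obtain ⟨x, hx⟩ := exists_pow_eq_smul_one_add_smul g.val n
      exact ⟨x, by simp [hf, hx]⟩
  have hdom : Nat.card (ZMod p × ZMod p) = p ^ 2 := by simp [sq]
  have hle : (Set.range f).ncard ≤ p ^ 2 := by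
    rw [← hdom]
    exact Finite.card_range_le f
  have heq : T = Set.range f := Set.eq_of_subset_of_ncard_le hsub (hle.trans hTcard.ge)
  have hinj : Function.Injective f := by
    have := Set.rangeFactorization_surjective (f := f)
    have hb := this.bijective_of_nat_card_le (by
      rw [hdom, ← hTcard, heq]; rfl)
    exact Set.rangeFactorization_injective.mp hb.1
  have hmem : f x ∈ T := heq ▸ Set.mem_range_self x
  rcases hmem with h | ⟨y, hy, h⟩
  · exact absurd (hinj (h.trans (by simp [hf]))) hx
  · exact ⟨y, hy, h⟩

theorem not_isSquare_discr_of_generator (h2 : (2 : ZMod p) ≠ 0)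
    {G : Subgroup (GL (Fin 2) (ZMod p))}
    (hcard : Nat.card G = p ^ 2 - 1) {g : GL (Fin 2) (ZMod p)}
    (hg : ∀ x ∈ G, x ∈ Subgroup.zpowers g) : ¬ IsSquare g.val.discr := by
  rintro ⟨s, hs⟩
  obtain ⟨y, -, hy⟩ := exists_mem_val_eq_smul_one_add_smul hcard hg
    (x := (-((g.val.trace + s) / 2), 1)) (by simp)
  apply y.det_ne_zero
  rw [hy]
  rw [discr_fin_two, trace_fin_two, det_fin_two] at hs
  simp [det_fin_two, trace_fin_two]
  field_simp
  linear_combination -hs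

/-- Every matrix with nonsquare discriminant is conjugate to an element of a cyclic subgroup of
order `p ^ 2 - 1`. -/
theorem exists_mem_conj_of_not_isSquare_discr (h2 : (2 : ZMod p) ≠ 0)
    {G : Subgroup (GL (Fin 2) (ZMod p))} (hcyc : IsCyclic G)
    (hcard : Nat.card G = p ^ 2 - 1) {A : GL (Fin 2) (ZMod p)} (hA : ¬ IsSquare A.val.discr) :
    ∃ g ∈ G, ∃ h, A = h * g * h⁻¹ := by
  obtain ⟨g, hg⟩ := hcyc.exists_generator
  replace hg : ∀ x ∈ G, x ∈ Subgroup.zpowers g.val := by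
    intro x hx
    obtain ⟨n, hn⟩ := hg ⟨x, hx⟩
    exact ⟨n, congrArg Subtype.val hn⟩
  have hD := not_isSquare_discr_of_generator h2 hcard hg
  set D := g.val.val.discr with hDdef
  have hD0 : D ≠ 0 := fun h ↦ hD (h ▸ IsSquare.zero)
  obtain ⟨b, hb⟩ : IsSquare (A.val.discr / D) := by
    by_contra hAD
    rw [← quadraticChar_neg_one_iff_not_isSquare] at hA hD hAD
    have := map_mul (quadraticChar (ZMod p)) (A.val.discr / D) D
    rw [div_mul_cancel₀ _ hD0, hA, hD, hAD] at this
    norm_num at this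
  have hb0 : b ≠ 0 := by
    rintro rfl
    refine hA ⟨0, ?_⟩
    field_simp at hb
    linear_combination hb
  obtain ⟨y, hy, hyv⟩ := exists_mem_val_eq_smul_one_add_smul hcard hg
    (x := ((A.val.trace - b * g.val.val.trace) / 2, b)) (by simp [hb0])
  have htr : A.val.trace = y.val.trace := by
    rw [hyv]
    simp [trace_fin_two]
    field_simp
    ring
  have hdisc : A.val.discr = y.val.discr := by
    rw [div_eq_iff hD0] at hb
    rw [hb, hDdef, hyv]
    simp [discr_fin_two, trace_fin_two, det_fin_two]
    ring
  have hdet : A.val.det = y.val.det := by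
    rw [discr_fin_two, discr_fin_two, htr] at hdisc
    have h4 : (2 * 2 : ZMod p) ≠ 0 := mul_ne_zero h2 h2
    apply mul_left_cancel₀ h4
    linear_combination -hdisc
  exact ⟨y, hy, GeneralLinearGroup.exists_eq_conj_of_trace_eq_of_det_eq (hdisc ▸ hA) htr hdet⟩

theorem pow_three_lt_card_not_isSquare_discr (hp : 5 ≤ p) (h2 : (2 : ZMod p) ≠ 0)
    (h3 : (3 : ZMod p) ≠ 0) {D : ZMod p} (hD : ¬ IsSquare D) :
    p ^ 3 < Nat.card {A : GL (Fin 2) (ZMod p) | ¬ IsSquare A.val.discr} := by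
  have hD4 : ¬ IsSquare (4 * D) := by
    rintro ⟨s, hs⟩
    refine hD ⟨s / 2, ?_⟩
    field_simp
    linear_combination hs
  have h4 : (4 : ZMod p) ≠ 0 := by
    rw [show (4 : ZMod p) = 2 * 2 by norm_num]
    exact mul_ne_zero h2 h2
  have hDne : 4 * D ≠ D := by
    intro h
    have : 3 * D = 0 := by linear_combination h
    rcases mul_eq_zero.mp this with h | h
    · exact h3 h
    · exact hD (h ▸ IsSquare.zero)
  let E : Bool → ZMod p := fun b ↦ cond b D (4 * D)
  have hE (b : Bool) : ¬ IsSquare (E b) := by cases b <;> assumption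
  have hEinj : Function.Injective E := by
    intro b b' h
    cases b <;> cases b'
    · rfl
    · exact absurd h hDne
    · exact absurd h.symm hDne
    · rfl
  let N : ZMod p × ZMod p × (ZMod p)ˣ × Bool → Matrix (Fin 2) (Fin 2) (ZMod p) :=
    fun x ↦ !![x.1, (E x.2.2.2 - x.2.1 ^ 2) / (4 * x.2.2.1); (x.2.2.1 : ZMod p), x.1 - x.2.1]
  have hN (x) : (N x).discr = E x.2.2.2 := by
    have := x.2.2.1.ne_zero
    simp only [N, discr_fin_two, trace_fin_two, det_fin_two, of_apply, cons_val', cons_val_zero,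
      cons_val_one, cons_val_fin_one]
    field_simp
    ring
  have hN' (x) : ¬ IsSquare (N x).discr := hN x ▸ hE _
  let f (x) : {A : GL (Fin 2) (ZMod p) | ¬ IsSquare A.val.discr} :=
    ⟨GeneralLinearGroup.mkOfDetNeZero (N x) (det_ne_zero_of_not_isSquare_discr (hN' x)), hN' x⟩
  have hf : Function.Injective f := by
    intro x y h
    have h' : N x = N y := congrArg (fun A ↦ A.val.val) h
    have hEE : E x.2.2.2 = E y.2.2.2 := by rw [← hN x, ← hN y, h']
    have h00 : x.1 = y.1 := congrFun (congrFun h' 0) 0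
    have h10 : (x.2.2.1 : ZMod p) = y.2.2.1 := congrFun (congrFun h' 1) 0
    have h11 : x.1 - x.2.1 = y.1 - y.2.1 := congrFun (congrFun h' 1) 1
    refine Prod.ext h00 (Prod.ext ?_ (Prod.ext (Units.ext h10) (hEinj hEE)))
    linear_combination h00 - h11
  refine lt_of_lt_of_le ?_ (Nat.card_le_card_of_injective f hf)
  have hcard : Nat.card (ZMod p × ZMod p × (ZMod p)ˣ × Bool) = p * (p * ((p - 1) * 2)) := by
    simp [Nat.totient_prime (Fact.out : p.Prime)]
  rw [hcard]
  obtain ⟨k, rfl⟩ : ∃ k, p = k + 5 := ⟨p - 5, by omega⟩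
  rw [show k + 5 - 1 = k + 4 by omega]
  nlinarith [mul_pos (show 0 < k + 5 by omega) (show 0 < k + 5 by omega)]

/-- The closure of the matrices with nonsquare discriminant contains the upper triangular
transvections. -/
theorem exists_transvection_mem_closure_not_isSquare_discr (h2 : (2 : ZMod p) ≠ 0) {D : ZMod p}
    (hD : ¬ IsSquare D) (x : ZMod p) :
    ∃ T ∈ Subgroup.closure {A : GL (Fin 2) (ZMod p) | ¬ IsSquare A.val.discr},
      T.val = !![1, x; 0, 1] := by
  have h4 : (4 : ZMod p) ≠ 0 := by
    rw [show (4 : ZMod p) = 2 * 2 by norm_num]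
    exact mul_ne_zero h2 h2
  set t : ZMod p := -x / 2 with ht
  set e : ZMod p := (t ^ 2 - D) / 4 with he
  have hA : (!![0, -e; 1, t]).discr = D := by
    simp [discr_fin_two, trace_fin_two, det_fin_two, he]
    field_simp
    ring
  have hB : (!![x, -e + x * t; 1, t]).discr = D := by
    simp [discr_fin_two, trace_fin_two, det_fin_two, he, ht]
    field_simp
    ring
  rw [← hA] at hD
  have hD' := hD
  rw [hA, ← hB] at hD'
  let A := GeneralLinearGroup.mkOfDetNeZero _ (det_ne_zero_of_not_isSquare_discr hD)
  let B := GeneralLinearGroup.mkOfDetNeZero _ (det_ne_zero_of_not_isSquare_discr hD')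
  refine ⟨B * A⁻¹, mul_mem (Subgroup.subset_closure hD')
    (inv_mem (Subgroup.subset_closure hD)), ?_⟩
  rw [Units.val_mul, Units.mul_inv_eq_iff_eq_mul]
  change !![x, -e + x * t; 1, t] = !![1, x; 0, 1] * !![0, -e; 1, t]
  simp

theorem closure_not_isSquare_discr (h2 : (2 : ZMod p) ≠ 0) {D : ZMod p} (hD : ¬ IsSquare D) :
    Subgroup.closure {A : GL (Fin 2) (ZMod p) | ¬ IsSquare A.val.discr} = ⊤ := by
  have h4 : (4 : ZMod p) ≠ 0 := by
    rw [show (4 : ZMod p) = 2 * 2 by norm_num]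
    exact mul_ne_zero h2 h2
  set H := Subgroup.closure {A : GL (Fin 2) (ZMod p) | ¬ IsSquare A.val.discr}
  have main (M : GL (Fin 2) (ZMod p)) (hM : M.val 1 0 ≠ 0) : M ∈ H := by
    obtain ⟨t, ht⟩ := ZMod.exists_not_isSquare_sq_sub (mul_ne_zero h4 M.det_ne_zero) hD
    obtain ⟨T, hT, hTv⟩ := exists_transvection_mem_closure_not_isSquare_discr h2 hD
      ((t - M.val.trace) / M.val 1 0)
    rw [← Subgroup.mul_mem_cancel_left _ hT]
    refine Subgroup.subset_closure ?_
    have htr : (T * M).val.trace = t := by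
      rw [Units.val_mul, hTv]
      simp only [trace_fin_two, mul_apply, Fin.sum_univ_two, of_apply, cons_val', cons_val_zero,
        cons_val_one, cons_val_fin_one]
      field_simp
      ring
    have hdet : (T * M).val.det = M.val.det := by
      rw [Units.val_mul, det_mul, hTv]
      simp [det_fin_two_of]
    rwa [Set.mem_ofPred_eq, discr_fin_two, htr, hdet]
  rw [eq_top_iff]
  rintro M -
  by_cases hM : M.val 1 0 = 0
  · let L : GL (Fin 2) (ZMod p) := GeneralLinearGroup.mkOfDetNeZero !![1, 0; 1, 1] (by simp)
    have hL : L ∈ H := main L (by simp [L, GeneralLinearGroup.mkOfDetNeZero])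
    rw [← Subgroup.mul_mem_cancel_left _ hL]
    refine main _ ?_
    have h0 := M.det_ne_zero
    rw [det_fin_two, hM, mul_zero, sub_zero] at h0
    rw [Units.val_mul]
    simpa [L, GeneralLinearGroup.mkOfDetNeZero, mul_apply, Fin.sum_univ_two, hM] using
      left_ne_zero_of_mul h0
  · exact main M hM

end NonsplitCartan

/-- **Lemma (non-split Cartan conjugates).** Let `p ≥ 5` be a prime and let `G` be a
non-split Cartan subgroup of `GL₂(𝔽_p)`, i.e. (equivalently) a cyclic subgroup of order
`p² - 1`.  Then the set of all conjugates `h * g * h⁻¹` of elements `g` of `G` by elements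
`h` of `GL₂(𝔽_p)` has cardinality strictly greater than `p³`, and it generates `GL₂(𝔽_p)`
as a group. -/
theorem nonsplit_cartan_conjugates_generate (p : ℕ) [Fact p.Prime] (hp : 5 ≤ p)
    (G : Subgroup (GL (Fin 2) (ZMod p))) (hcyc : IsCyclic G)
    (hcard : Nat.card G = p ^ 2 - 1) :
    (p : ℕ) ^ 3 < Nat.card {x : GL (Fin 2) (ZMod p) | ∃ g ∈ G, ∃ h, x = h * g * h⁻¹} ∧
      Subgroup.closure {x : GL (Fin 2) (ZMod p) | ∃ g ∈ G, ∃ h, x = h * g * h⁻¹} = ⊤ := by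
  have hcast (n : ℕ) (hn : 0 < n) (hnp : n < p) : (n : ZMod p) ≠ 0 := by
    rw [Ne, ZMod.natCast_eq_zero_iff]
    exact Nat.not_dvd_of_pos_of_lt hn hnp
  have h2 : (2 : ZMod p) ≠ 0 := by exact_mod_cast hcast 2 (by omega) (by omega)
  have h3 : (3 : ZMod p) ≠ 0 := by exact_mod_cast hcast 3 (by omega) (by omega)
  obtain ⟨D, hD⟩ := FiniteField.exists_nonsquare (F := ZMod p) (by
    rw [ZMod.ringChar_zmod_n]; omega)
  have hsub : {A : GL (Fin 2) (ZMod p) | ¬ IsSquare A.val.discr} ⊆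
      {x | ∃ g ∈ G, ∃ h, x = h * g * h⁻¹} :=
    fun A hA ↦ exists_mem_conj_of_not_isSquare_discr h2 hcyc hcard hA
  refine ⟨(pow_three_lt_card_not_isSquare_discr hp h2 h3 hD).trans_le
    (Nat.card_mono (Set.toFinite _) hsub), ?_⟩
  rw [eq_top_iff, ← closure_not_isSquare_discr h2 hD]
  exact Subgroup.closure_mono hsub
end
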